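/- Let g, h ∈ G = GL(α+k∞, ℚ_p) and u₁, u₂, u₃, u₄ ∈ O(∞, ℤ_p). Then there exists N₀ such that for all N ≥ N₀ there exist w, w' ∈ O(∞, ℤ_p) with (𝔍(u₁)·g·𝔍(u₂))·𝔍(Θ_N)·(𝔍(u₃)·h·𝔍(u₄)) = 𝔍(w)·(g·𝔍(Θ_N)·h)·𝔍(w'). (The product of double cosets K\G/K does not depend on the choice of representatives.) -/

import Mathlib

open scoped BigOperators

/-- The identity matrix over `ℚ_p`, with an arbitrary index set. -/
noncomputable def idMat (p : ℕ) [Fact p.Prime] {I : Type*} [DecidableEq I] : I → I → ℚ_[p] :=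
  fun i j => if i = j then 1 else 0

/-- Product of two (possibly infinite) matrices over `ℚ_p`; the sum is a `finsum`, which is
well defined for the finitary matrices considered here. -/
noncomputable def matMul (p : ℕ) [Fact p.Prime] {I : Type*} (A B : I → I → ℚ_[p]) : I → I → ℚ_[p] :=
  fun i j => ∑ᶠ l, A i l * B l j

/-- A matrix is *finitary* if it differs from the identity matrix in finitely many entries. -/
def IsFinitary (p : ℕ) [Fact p.Prime] {I : Type*} [DecidableEq I] (A : I → I → ℚ_[p]) : Prop :=
  {x : I × I | A x.1 x.2 ≠ idMat p x.1 x.2}.Finite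

/-- A matrix is invertible if it has a two-sided inverse. -/
def IsInvMat (p : ℕ) [Fact p.Prime] {I : Type*} [DecidableEq I] (A : I → I → ℚ_[p]) : Prop :=
  ∃ B : I → I → ℚ_[p], matMul p A B = idMat p ∧ matMul p B A = idMat p

/-- Membership in `O(∞, ℤ_p)`: an `ℕ × ℕ` matrix with entries in `ℤ_p` (p-adic norm at most 1),
differing from the identity in finitely many entries, with `uᵗ u = 1`. -/
def IsOrth (p : ℕ) [Fact p.Prime] (u : ℕ → ℕ → ℚ_[p]) : Prop :=
  (∀ i j, ‖u i j‖ ≤ 1) ∧ IsFinitary p u ∧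
    ∀ i j, (∑ᶠ l, u l i * u l j) = idMat p i j

/-- The diagonal embedding `𝔍 : O(∞, ℤ_p) → GL(α + k∞, ℚ_p)`: identity on the first `α`
coordinates, and `u` on each of the `k` copies of the `ℕ`-indexed coordinates. -/
noncomputable def Jembed (p : ℕ) [Fact p.Prime] (α k : ℕ) (u : ℕ → ℕ → ℚ_[p]) :
    (Fin α ⊕ Fin k × ℕ) → (Fin α ⊕ Fin k × ℕ) → ℚ_[p] :=
  fun i j =>
    match i, j with
    | Sum.inl a, Sum.inl b => if a = b then 1 else 0
    | Sum.inr si, Sum.inr tj => if si.1 = tj.1 then u si.2 tj.2 else 0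
    | _, _ => 0

/-- The matrix `Θ_N ∈ O(∞, ℤ_p)` exchanging `e_i` and `e_{N+i}` for `i < N` and fixing `e_j`
for `j ≥ 2N` (0-indexed). -/
noncomputable def ThetaMat (p : ℕ) [Fact p.Prime] (N : ℕ) : ℕ → ℕ → ℚ_[p] :=
  fun i j => if i = (if j < N then j + N else if j < 2 * N then j - N else j) then 1 else 0


section FinitaryMatrices

variable {p : ℕ} [Fact p.Prime] {I : Type*} [DecidableEq I]

/-- `A` agrees with the identity matrix outside of the block `F × F`. -/
def IsIdOff (A : I → I → ℚ_[p]) (F : Set I) : Prop :=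
  ∀ i j, i ∉ F ∨ j ∉ F → A i j = idMat p i j

theorem IsIdOff.mono {A : I → I → ℚ_[p]} {F E : Set I} (hA : IsIdOff A F) (h : F ⊆ E) :
    IsIdOff A E :=
  fun i j hij => hA i j (hij.imp (fun hi hF => hi (h hF)) fun hj hF => hj (h hF))

theorem IsFinitary.exists_isIdOff {A : I → I → ℚ_[p]} (hA : IsFinitary p A) :
    ∃ F : Set I, F.Finite ∧ IsIdOff A F := by
  refine ⟨_, (hA.image Prod.fst).union (hA.image Prod.snd), fun i j hij => ?_⟩
  by_contra hne
  rcases hij with hi | hj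
  · exact hi (Or.inl ⟨(i, j), hne, rfl⟩)
  · exact hj (Or.inr ⟨(i, j), hne, rfl⟩)

theorem IsIdOff.isFinitary {A : I → I → ℚ_[p]} {F : Set I} (hA : IsIdOff A F)
    (hF : F.Finite) : IsFinitary p A := by
  refine (hF.prod hF).subset fun x hx => ?_
  by_contra hne
  exact hx (hA _ _ (not_and_or.mp hne))

theorem matMul_apply_of_left {A B : I → I → ℚ_[p]} {i : I} (m : I)
    (hA : ∀ l, A i l = if l = m then 1 else 0) (j : I) : matMul p A B i j = B m j := by
  rw [matMul, finsum_eq_single _ m fun l hl => by simp [hA, hl]]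
  simp [hA]

theorem matMul_apply_of_right {A B : I → I → ℚ_[p]} {j : I} (m : I)
    (hB : ∀ l, B l j = if l = m then 1 else 0) (i : I) : matMul p A B i j = A i m := by
  rw [matMul, finsum_eq_single _ m fun l hl => by simp [hB, hl]]
  simp [hB]

theorem IsIdOff.matMul_apply_left {A : I → I → ℚ_[p]} {F : Set I} (hA : IsIdOff A F)
    (B : I → I → ℚ_[p]) {i : I} (hi : i ∉ F) (j : I) : matMul p A B i j = B i j :=
  matMul_apply_of_left i (fun l => by simp [hA i l (.inl hi), idMat, eq_comm]) j

theorem IsIdOff.matMul_apply_right {B : I → I → ℚ_[p]} {F : Set I} (hB : IsIdOff B F)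
    (A : I → I → ℚ_[p]) (i : I) {j : I} (hj : j ∉ F) : matMul p A B i j = A i j :=
  matMul_apply_of_right j (fun l => by simp [hB l j (.inr hj), idMat]) i

theorem isIdOff_idMat (F : Set I) : IsIdOff (idMat p) F := fun _ _ _ => rfl

theorem IsIdOff.matMul {A B : I → I → ℚ_[p]} {F : Set I} (hA : IsIdOff A F)
    (hB : IsIdOff B F) : IsIdOff (matMul p A B) F := by
  rintro i j (hi | hj)
  · rw [hA.matMul_apply_left B hi, hB i j (.inl hi)]
  · rw [hB.matMul_apply_right A i hj, hA i j (.inr hj)]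

theorem IsIdOff.matMul_apply_of_disjoint {A B : I → I → ℚ_[p]} {F E : Set I}
    (hA : IsIdOff A F) (hB : IsIdOff B E) (hFE : Disjoint F E) (i j : I) :
    _root_.matMul p A B i j = A i j + B i j - idMat p i j := by
  by_cases hi : i ∈ F
  · by_cases hj : j ∈ E
    · have hi' : i ∉ E := Set.disjoint_left.mp hFE hi
      have hj' : j ∉ F := Set.disjoint_right.mp hFE hj
      have hij : i ≠ j := fun h => hi' (h ▸ hj)
      rw [hA i j (.inr hj'), hB i j (.inl hi'), _root_.matMul, finsum_eq_zero_of_forall_eq_zero]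
      · simp [idMat, hij]
      · intro l
        by_cases hl : l ∈ F
        · have hl' : l ∉ E := Set.disjoint_left.mp hFE hl
          have hlj : l ≠ j := fun h => hl' (h ▸ hj)
          simp [hB l j (.inl hl'), idMat, hlj]
        · have hil : i ≠ l := fun h => hl (h ▸ hi)
          simp [hA i l (.inr hl), idMat, hil]
    · rw [hB.matMul_apply_right A i hj, hB i j (.inr hj), add_sub_cancel_right]
  · rw [hA.matMul_apply_left B hi, hA i j (.inl hi), add_sub_cancel_left]

theorem IsIdOff.matMul_comm {A B : I → I → ℚ_[p]} {F E : Set I} (hA : IsIdOff A F)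
    (hB : IsIdOff B E) (hFE : Disjoint F E) : _root_.matMul p A B = _root_.matMul p B A := by
  ext i j
  rw [hA.matMul_apply_of_disjoint hB hFE, hB.matMul_apply_of_disjoint hA hFE.symm, add_comm]

theorem IsFinitary.matMul {A B : I → I → ℚ_[p]} (hA : IsFinitary p A)
    (hB : IsFinitary p B) : IsFinitary p (matMul p A B) := by
  obtain ⟨F, hF, hAF⟩ := hA.exists_isIdOff
  obtain ⟨E, hE, hBE⟩ := hB.exists_isIdOff
  exact ((hAF.mono Set.subset_union_left).matMul (hBE.mono Set.subset_union_right)).isFinitary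
    (hF.union hE)

theorem IsFinitary.transpose {A : I → I → ℚ_[p]} (hA : IsFinitary p A) :
    IsFinitary p fun i j => A j i := by
  obtain ⟨F, hF, hAF⟩ := hA.exists_isIdOff
  refine IsIdOff.isFinitary (F := F) (fun i j hij => ?_) hF
  simp [hAF j i hij.symm, idMat, eq_comm]

theorem IsFinitary.finite_support_row {A : I → I → ℚ_[p]} (hA : IsFinitary p A) (i : I) :
    {l | A i l ≠ 0}.Finite := by
  obtain ⟨F, hF, hAF⟩ := hA.exists_isIdOff
  refine (hF.insert i).subset fun l hl => ?_
  by_contra hne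
  rw [Set.mem_insert_iff, not_or] at hne
  exact hl (by simp [hAF i l (.inr hne.2), idMat, Ne.symm hne.1])

theorem IsFinitary.finite_support_col {A : I → I → ℚ_[p]} (hA : IsFinitary p A) (j : I) :
    {l | A l j ≠ 0}.Finite :=
  hA.transpose.finite_support_row j

theorem matMul_assoc_of_isFinitary {A C : I → I → ℚ_[p]} (hA : IsFinitary p A)
    (B : I → I → ℚ_[p]) (hC : IsFinitary p C) :
    matMul p (matMul p A B) C = matMul p A (matMul p B C) := by
  ext i j
  have hS := hA.finite_support_row i
  have hT := hC.finite_support_col j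
  have hAB (D : I → ℚ_[p]) : ∑ᶠ l, A i l * D l = ∑ l ∈ hS.toFinset, A i l * D l :=
    finsum_eq_sum_of_support_subset _ fun l hl => by
      simpa using left_ne_zero_of_mul hl
  have hBC (D : I → ℚ_[p]) : ∑ᶠ l, D l * C l j = ∑ l ∈ hT.toFinset, D l * C l j :=
    finsum_eq_sum_of_support_subset _ fun l hl => by
      simpa using right_ne_zero_of_mul hl
  simp only [matMul]
  rw [hBC, hAB]
  simp only [hAB, hBC, Finset.sum_mul, Finset.mul_sum, mul_assoc]
  exact Finset.sum_comm

variable (p I) in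
/-- The monoid of finitary matrices. -/
def FinitaryMatrix : Type _ := {A : I → I → ℚ_[p] // IsFinitary p A}

noncomputable instance : Monoid (FinitaryMatrix p I) where
  mul A B := ⟨matMul p A.1 B.1, A.2.matMul B.2⟩
  one := ⟨idMat p, (isIdOff_idMat ∅).isFinitary Set.finite_empty⟩
  mul_assoc A B C := Subtype.ext (matMul_assoc_of_isFinitary A.2 B.1 C.2)
  one_mul A := Subtype.ext <| by
    ext i j
    exact (isIdOff_idMat ∅).matMul_apply_left A.1 (Set.notMem_empty i) j
  mul_one A := Subtype.ext <| by
    ext i j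
    exact (isIdOff_idMat ∅).matMul_apply_right A.1 i (Set.notMem_empty j)

end FinitaryMatrices

section Orthogonal

variable {p : ℕ} [Fact p.Prime]

theorem IsOrth.matMul {u v : ℕ → ℕ → ℚ_[p]} (hu : IsOrth p u) (hv : IsOrth p v) :
    IsOrth p (matMul p u v) := by
  refine ⟨fun i j => ?_, hu.2.1.matMul hv.2.1, fun i j => ?_⟩
  · refine finsum_induction (fun x : ℚ_[p] => ‖x‖ ≤ 1) (by simp)
      (fun x y hx hy => (IsUltrametricDist.norm_add_le_max x y).trans (max_le hx hy)) fun l => ?_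
    rw [norm_mul]
    exact mul_le_one₀ (hu.1 _ _) (norm_nonneg _) (hv.1 _ _)
  · let U : FinitaryMatrix p ℕ := ⟨u, hu.2.1⟩
    let V : FinitaryMatrix p ℕ := ⟨v, hv.2.1⟩
    let U' : FinitaryMatrix p ℕ := ⟨_, hu.2.1.transpose⟩
    let V' : FinitaryMatrix p ℕ := ⟨_, hv.2.1.transpose⟩
    have hU : U' * U = 1 := Subtype.ext (funext₂ hu.2.2)
    have hV : V' * V = 1 := Subtype.ext (funext₂ hv.2.2)
    have hUV : (V' * U') * (U * V) = 1 := by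
      rw [mul_assoc, ← mul_assoc U', hU, one_mul, hV]
    have hT : (V' * U').1 = fun i j => _root_.matMul p u v j i := by
      ext i j
      exact finsum_congr fun l => mul_comm _ _
    have := congrFun (congrFun (congrArg Subtype.val hUV) i) j
    change _root_.matMul p (V' * U').1 _ i j = _ at this
    rwa [hT] at this

theorem IsIdOff.comp_perm {u : ℕ → ℕ → ℚ_[p]} {F : Set ℕ} (hu : IsIdOff u F)
    (σ : Equiv.Perm ℕ) : IsIdOff (fun i j => u (σ i) (σ j)) (σ ⁻¹' F) := fun i j hij => by
  simp [hu (σ i) (σ j) hij, idMat]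

theorem IsOrth.comp_perm {u : ℕ → ℕ → ℚ_[p]} (hu : IsOrth p u) (σ : Equiv.Perm ℕ) :
    IsOrth p fun i j => u (σ i) (σ j) := by
  obtain ⟨F, hF, huF⟩ := hu.2.1.exists_isIdOff
  refine ⟨fun i j => hu.1 _ _,
    (huF.comp_perm σ).isFinitary (hF.preimage σ.injective.injOn), fun i j => ?_⟩
  rw [finsum_comp_equiv σ (f := fun l => u l (σ i) * u l (σ j)), hu.2.2]
  simp [idMat]

end Orthogonal

section Theta

variable {p : ℕ} [Fact p.Prime]

/-- The involution of `ℕ` exchanging `i` and `N + i` for `i < N`. -/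
def blockSwap (N : ℕ) : Equiv.Perm ℕ :=
  Function.Involutive.toPerm
    (fun j => if j < N then j + N else if j < 2 * N then j - N else j) fun j => by grind

theorem blockSwap_apply (N j : ℕ) :
    blockSwap N j = if j < N then j + N else if j < 2 * N then j - N else j := rfl

theorem thetaMat_apply (N i j : ℕ) :
    ThetaMat p N i j = if i = blockSwap N j then 1 else 0 := rfl

theorem blockSwap_blockSwap (N j : ℕ) : blockSwap N (blockSwap N j) = j := by
  grind [blockSwap_apply]

theorem matMul_thetaMat (A : ℕ → ℕ → ℚ_[p]) (N i j : ℕ) :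
    matMul p A (ThetaMat p N) i j = A i (blockSwap N j) :=
  matMul_apply_of_right _ (fun l => thetaMat_apply N l j) i

theorem thetaMat_matMul (A : ℕ → ℕ → ℚ_[p]) (N i j : ℕ) :
    matMul p (ThetaMat p N) A i j = A (blockSwap N i) j :=
  matMul_apply_of_left _ (fun l => by
    rw [thetaMat_apply]
    refine if_congr ⟨fun h => ?_, fun h => ?_⟩ rfl rfl <;> rw [h, blockSwap_blockSwap]) j

theorem isFinitary_thetaMat (N : ℕ) : IsFinitary p (ThetaMat p N) := by
  refine IsIdOff.isFinitary (F := Set.Iio (2 * N)) (fun i j hij => ?_) (Set.finite_Iio _)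
  simp only [Set.mem_Iio, not_lt] at hij
  rw [thetaMat_apply, idMat]
  refine if_congr ?_ rfl rfl
  grind [blockSwap_apply]

theorem disjoint_preimage_blockSwap {n N : ℕ} (h : n ≤ N) :
    Disjoint (Set.Iio n) (blockSwap N ⁻¹' Set.Iio n) := by
  refine Set.disjoint_left.mpr fun i hi hi' => ?_
  simp only [Set.mem_preimage, Set.mem_Iio] at hi hi'
  grind [blockSwap_apply]

/-- Conjugation by `Θ_N` moves both factors to the opposite side of `Θ_N`. -/
theorem matMul_thetaMat_matMul {u v : ℕ → ℕ → ℚ_[p]} {n N : ℕ} (hu : IsIdOff u (Set.Iio n))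
    (hv : IsIdOff v (Set.Iio n)) (h : n ≤ N) :
    matMul p (matMul p u (ThetaMat p N)) v =
      matMul p (matMul p (fun i j => v (blockSwap N i) (blockSwap N j)) (ThetaMat p N))
        fun i j => u (blockSwap N i) (blockSwap N j) := by
  have hv' := hv.comp_perm (blockSwap N)
  have hfin : (blockSwap N ⁻¹' Set.Iio n).Finite :=
    (Set.finite_Iio n).preimage (blockSwap N).injective.injOn
  have hu' := hu.comp_perm (blockSwap N)
  have hΘ := isFinitary_thetaMat (p := p) N
  rw [matMul_assoc_of_isFinitary (hu.isFinitary (Set.finite_Iio n)) _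
      (hv.isFinitary (Set.finite_Iio n)),
    matMul_assoc_of_isFinitary (hv'.isFinitary hfin) _ (hu'.isFinitary hfin)]
  have hleft : matMul p (ThetaMat p N) v =
      matMul p (fun i j => v (blockSwap N i) (blockSwap N j)) (ThetaMat p N) := by
    ext i j
    rw [thetaMat_matMul, matMul_thetaMat, blockSwap_blockSwap]
  have hright : matMul p (ThetaMat p N) (fun i j => u (blockSwap N i) (blockSwap N j)) =
      matMul p u (ThetaMat p N) := by
    ext i j
    rw [thetaMat_matMul, matMul_thetaMat, blockSwap_blockSwap]
  rw [hleft, hright, ← matMul_assoc_of_isFinitary (hu.isFinitary (Set.finite_Iio n)) _ hΘ,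
    ← matMul_assoc_of_isFinitary (hv'.isFinitary hfin) _ hΘ,
    hu.matMul_comm hv' (disjoint_preimage_blockSwap h)]

end Theta

section Jembed

variable {p : ℕ} [Fact p.Prime] {α k : ℕ}

/-- The coordinates of `α + k∞` whose `ℕ`-component lies in `F`. -/
def natCoords (α k : ℕ) (F : Set ℕ) : Set (Fin α ⊕ Fin k × ℕ) :=
  Sum.inr '' (Prod.snd ⁻¹' F)

theorem IsIdOff.jembed {u : ℕ → ℕ → ℚ_[p]} {F : Set ℕ} (hu : IsIdOff u F) :
    IsIdOff (Jembed p α k u) (natCoords α k F) := by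
  rintro (a | ⟨s, i⟩) (b | ⟨t, j⟩) hij
  · simp [Jembed, idMat]
  · simp [Jembed, idMat]
  · simp [Jembed, idMat]
  · have hij' : i ∉ F ∨ j ∉ F := by simpa [natCoords] using hij
    by_cases hst : s = t <;> simp [Jembed, idMat, hu i j hij', hst]

theorem IsFinitary.jembed {u : ℕ → ℕ → ℚ_[p]} (hu : IsFinitary p u) :
    IsFinitary p (Jembed p α k u) := by
  obtain ⟨F, hF, huF⟩ := hu.exists_isIdOff
  refine (huF.jembed (α := α) (k := k)).isFinitary (Set.Finite.image _ ?_)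
  exact (Set.finite_univ.prod hF).subset fun x hx => ⟨Set.mem_univ _, hx⟩

theorem jembed_matMul (u v : ℕ → ℕ → ℚ_[p]) :
    Jembed p α k (matMul p u v) = matMul p (Jembed p α k u) (Jembed p α k v) := by
  ext x y
  rcases x with a | ⟨s, i⟩
  · rw [matMul_apply_of_left (Sum.inl a) (by rintro (b | _) <;> simp [Jembed, eq_comm])]
    rcases y with b | y <;> simp [Jembed]
  · have hinj : Function.Injective fun l : ℕ => (Sum.inr (s, l) : Fin α ⊕ Fin k × ℕ) :=
      fun l l' h => by simpa using h
    have hsupp : (Function.support fun l =>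
        Jembed p α k u (Sum.inr (s, i)) l * Jembed p α k v l y) ⊆
        Set.range fun l : ℕ => (Sum.inr (s, l) : Fin α ⊕ Fin k × ℕ) := by
      rintro (b | ⟨t, l⟩) hl
      · simp [Jembed] at hl
      · by_cases hst : s = t
        · exact ⟨l, by rw [hst]⟩
        · simp [Jembed, hst] at hl
    rw [matMul, ← finsum_mem_univ, ← finsum_mem_inter_support, Set.univ_inter,
      ← Set.inter_eq_right.mpr hsupp, finsum_mem_inter_support, finsum_mem_range hinj]
    rcases y with b | ⟨t, j⟩
    · simp [Jembed]
    · by_cases hst : s = t <;> simp [Jembed, matMul, hst]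

/-- A finitary matrix over `α + k∞` involves only finitely many `ℕ`-coordinates. -/
theorem IsFinitary.exists_isIdOff_compl {g : (Fin α ⊕ Fin k × ℕ) → (Fin α ⊕ Fin k × ℕ) → ℚ_[p]}
    (hg : IsFinitary p g) : ∃ n : ℕ, IsIdOff g (natCoords α k (Set.Ici n))ᶜ := by
  obtain ⟨F, hF, hgF⟩ := hg.exists_isIdOff
  obtain ⟨n, hn⟩ := (hF.image (Sum.elim (fun _ => 0) Prod.snd)).bddAbove
  refine ⟨n + 1, hgF.mono ?_⟩
  rintro _ hx ⟨⟨s, i⟩, hi, rfl⟩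
  exact absurd (hn ⟨_, hx, rfl⟩) (by simpa using hi)

theorem IsFinitary.exists_isIdOff_Iio {u : ℕ → ℕ → ℚ_[p]} (hu : IsFinitary p u) :
    ∃ n : ℕ, IsIdOff u (Set.Iio n) := by
  obtain ⟨F, hF, huF⟩ := hu.exists_isIdOff
  obtain ⟨n, hn⟩ := hF.bddAbove
  exact ⟨n + 1, huF.mono fun i hi => Nat.lt_succ_of_le (hn hi)⟩

theorem disjoint_natCoords_preimage_blockSwap {n m N : ℕ} (hn : n ≤ N) (hm : m ≤ N) :
    Disjoint (natCoords α k (blockSwap N ⁻¹' Set.Iio n)) (natCoords α k (Set.Ici m))ᶜ := by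
  refine Set.disjoint_compl_right_iff_subset.mpr (Set.image_mono (Set.preimage_mono ?_))
  intro i hi
  simp only [Set.mem_preimage, Set.mem_Iio, Set.mem_Ici] at hi ⊢
  grind [blockSwap_apply]

end Jembed

theorem mul_mul_eq_of_swap {M : Type*} [Monoid M] {g h t u₁ u₂ u₃ u₄ a b : M}
    (hswap : u₂ * t * u₃ = a * t * b) (ha : a * g = g * a) (hb : b * h = h * b) :
    u₁ * g * u₂ * t * (u₃ * h * u₄) = u₁ * a * (g * t * h) * (b * u₄) :=
  calc u₁ * g * u₂ * t * (u₃ * h * u₄) = u₁ * g * (u₂ * t * u₃) * (h * u₄) := by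
        simp only [mul_assoc]
    _ = u₁ * (g * a) * t * (b * h) * u₄ := by rw [hswap]; simp only [mul_assoc]
    _ = u₁ * a * (g * t * h) * (b * u₄) := by rw [← ha, hb]; simp only [mul_assoc]

/-- **Independence of the double-coset product from the choice of representatives.**
For `g, h ∈ G = GL(α + k∞, ℚ_p)` and `u₁, u₂, u₃, u₄ ∈ O(∞, ℤ_p)`, there exists `N₀` such
that for all `N ≥ N₀` there exist `w, w' ∈ O(∞, ℤ_p)` with
`(𝔍(u₁)·g·𝔍(u₂))·𝔍(Θ_N)·(𝔍(u₃)·h·𝔍(u₄)) = 𝔍(w)·(g·𝔍(Θ_N)·h)·𝔍(w')`. -/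
theorem double_coset_product_independent_of_representatives (p : ℕ) [Fact p.Prime]
    (α k : ℕ) (hk : 1 ≤ k)
    (g h : (Fin α ⊕ Fin k × ℕ) → (Fin α ⊕ Fin k × ℕ) → ℚ_[p])
    (hgfin : IsFinitary p g) (hginv : IsInvMat p g)
    (hhfin : IsFinitary p h) (hhinv : IsInvMat p h)
    (u₁ u₂ u₃ u₄ : ℕ → ℕ → ℚ_[p])
    (hu₁ : IsOrth p u₁) (hu₂ : IsOrth p u₂) (hu₃ : IsOrth p u₃) (hu₄ : IsOrth p u₄) :
    ∃ N₀ : ℕ, ∀ N : ℕ, N₀ ≤ N →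
      ∃ w w' : ℕ → ℕ → ℚ_[p], IsOrth p w ∧ IsOrth p w' ∧
        matMul p
          (matMul p
            (matMul p (matMul p (Jembed p α k u₁) g) (Jembed p α k u₂))
            (Jembed p α k (ThetaMat p N)))
          (matMul p (matMul p (Jembed p α k u₃) h) (Jembed p α k u₄)) =
        matMul p
          (matMul p (Jembed p α k w)
            (matMul p (matMul p g (Jembed p α k (ThetaMat p N))) h))
          (Jembed p α k w') := by
  obtain ⟨n₂, hn₂⟩ := hu₂.2.1.exists_isIdOff_Iio
  obtain ⟨n₃, hn₃⟩ := hu₃.2.1.exists_isIdOff_Iio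
  obtain ⟨ng, hng⟩ := hgfin.exists_isIdOff_compl
  obtain ⟨nh, hnh⟩ := hhfin.exists_isIdOff_compl
  refine ⟨max (max n₂ n₃) (max ng nh), fun N hN => ?_⟩
  simp only [max_le_iff] at hN
  obtain ⟨⟨h₂N, h₃N⟩, hgN, hhN⟩ := hN
  have ha := hu₃.comp_perm (blockSwap N)
  have hb := hu₂.comp_perm (blockSwap N)
  have hswap := matMul_thetaMat_matMul
    (hn₂.mono (Set.Iio_subset_Iio (le_max_left n₂ n₃)))
    (hn₃.mono (Set.Iio_subset_Iio (le_max_right n₂ n₃))) (max_le h₂N h₃N)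
  have hga := (hn₃.comp_perm (blockSwap N)).jembed.matMul_comm hng
    (disjoint_natCoords_preimage_blockSwap h₃N hgN)
  have hhb := (hn₂.comp_perm (blockSwap N)).jembed.matMul_comm hnh
    (disjoint_natCoords_preimage_blockSwap h₂N hhN)
  refine ⟨_, _, hu₁.matMul ha, hb.matMul hu₄, ?_⟩
  have hJswap := congrArg (Jembed p α k) hswap
  simp only [jembed_matMul] at hJswap ⊢
  let J (u : ℕ → ℕ → ℚ_[p]) (hu : IsFinitary p u) : FinitaryMatrix p (Fin α ⊕ Fin k × ℕ) :=
    ⟨Jembed p α k u, hu.jembed⟩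
  exact congrArg Subtype.val (mul_mul_eq_of_swap (g := ⟨g, hgfin⟩) (h := ⟨h, hhfin⟩)
    (t := J _ (isFinitary_thetaMat N)) (u₁ := J u₁ hu₁.2.1) (u₂ := J u₂ hu₂.2.1)
    (u₃ := J u₃ hu₃.2.1) (u₄ := J u₄ hu₄.2.1) (a := J _ ha.2.1) (b := J _ hb.2.1)
    (Subtype.ext hJswap) (Subtype.ext hga) (Subtype.ext hhb))
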